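/- arXiv:2307.16212 — 7 statements merged into one kernel-verified Lean document; each statement's English description precedes it below -/
import Mathlib

section
/- Let A and B be finite nonempty types and let M : A → B → ℝ be a payoff matrix. For a response plan x : B → stdSimplex ℝ A and a mixed action y ∈ stdSimplex ℝ B, define the expected payoff F(x, y) = ∑_{b} y b · ∑_{a} (x b) a · M a b. Then there exist x* : B → stdSimplex ℝ A and y* ∈ stdSimplex ℝ B such that for all x : B → stdSimplex ℝ A and all y ∈ stdSimplex ℝ B: F(x, y*) ≤ F(x*, y*) ≤ F(x*, y). (Existence of a Nash equilibrium in behavioral strategies for the zero-sum extensive-form game in which the adversary-player moves first and the agent-player responds to each branch; Lemma A.1 of the paper.) -/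
open scoped BigOperators

/-- Existence of a Nash equilibrium in behavioral strategies for the zero-sum
extensive-form game in which the adversary-player moves first (choosing
`y ∈ stdSimplex ℝ B`) and the agent-player responds with a plan
`x : B → stdSimplex ℝ A`.  The agent's expected payoff is
`F x y = ∑ b, y b * ∑ a, (x b) a * M a b`. -/
theorem efg_nash_equilibrium_exists
    {A B : Type*} [Fintype A] [Fintype B] [Nonempty A] [Nonempty B]
    (M : A → B → ℝ) :
    ∃ (xs : B → stdSimplex ℝ A) (ys : stdSimplex ℝ B),
      ∀ (x : B → stdSimplex ℝ A) (y : stdSimplex ℝ B),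
        (∑ b, (ys : B → ℝ) b * ∑ a, (x b : A → ℝ) a * M a b) ≤
          (∑ b, (ys : B → ℝ) b * ∑ a, (xs b : A → ℝ) a * M a b) ∧
        (∑ b, (ys : B → ℝ) b * ∑ a, (xs b : A → ℝ) a * M a b) ≤
          (∑ b, (y : B → ℝ) b * ∑ a, (xs b : A → ℝ) a * M a b) := by
  classical
  choose best hbest using fun b => Finite.exists_max fun a => M a b
  obtain ⟨b₀, hb₀⟩ := Finite.exists_min fun b => M (best b) b
  have average_le : ∀ (p : stdSimplex ℝ A) b, ∑ a, (p : A → ℝ) a * M a b ≤ M (best b) b := by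
    intro p b
    calc ∑ a, (p : A → ℝ) a * M a b
        ≤ ∑ a, (p : A → ℝ) a * M (best b) b :=
          Finset.sum_le_sum fun a _ => mul_le_mul_of_nonneg_left (hbest b a) (p.2.1 a)
      _ = M (best b) b := by rw [← Finset.sum_mul, stdSimplex.sum_eq_one p, one_mul]
  have le_average : ∀ y : stdSimplex ℝ B,
      M (best b₀) b₀ ≤ ∑ b, (y : B → ℝ) b * M (best b) b := by
    intro y
    calc M (best b₀) b₀ = ∑ b, (y : B → ℝ) b * M (best b₀) b₀ := by
          rw [← Finset.sum_mul, stdSimplex.sum_eq_one y, one_mul]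
      _ ≤ ∑ b, (y : B → ℝ) b * M (best b) b :=
          Finset.sum_le_sum fun b _ => mul_le_mul_of_nonneg_left (hb₀ b) (y.2.1 b)
  refine ⟨fun b => ⟨Pi.single (best b) 1, single_mem_stdSimplex ℝ (best b)⟩,
    ⟨Pi.single b₀ 1, single_mem_stdSimplex ℝ b₀⟩, fun x y => ⟨?_, ?_⟩⟩
  · simpa [Pi.single_apply] using average_le (x b₀) b₀
  · simpa [Pi.single_apply] using le_average y
end

section
/- Let A and B be finite nonempty types and define, for M : A → B → ℝ, the game value Val M = ⨆_{x : B → stdSimplex ℝ A} ⨅_{y ∈ stdSimplex ℝ B} ∑_{b} y b · ∑_{a} (x b) a · M a b. If M, N : A → B → ℝ and ε ≥ 0 satisfy |M a b − N a b| ≤ ε for all a ∈ A, b ∈ B, then |Val M − Val N| ≤ ε. (Nonexpansiveness of the matrix-game value; the key step in the contraction proof for the Q-function operator, Proposition C.1.) -/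
open scoped BigOperators

/-- The value of the matrix game in behavioral strategies: the adversary moves
first with a mixed action `y ∈ stdSimplex ℝ B`, the agent responds with a plan
`x : B → stdSimplex ℝ A`. -/
noncomputable def matrixGameVal {A B : Type*} [Fintype A] [Fintype B]
    (M : A → B → ℝ) : ℝ :=
  ⨆ x : B → stdSimplex ℝ A, ⨅ y : stdSimplex ℝ B,
    ∑ b, (y : B → ℝ) b * ∑ a, (x b : A → ℝ) a * M a b

/-- A weighted average of quantities bounded by `c` is bounded by `c`. -/
lemma abs_sum_stdSimplex_mul_le {ι : Type*} [Fintype ι] (w : stdSimplex ℝ ι) {f : ι → ℝ} {c : ℝ}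
    (hf : ∀ i, |f i| ≤ c) : |∑ i, (w : ι → ℝ) i * f i| ≤ c :=
  calc |∑ i, (w : ι → ℝ) i * f i| ≤ ∑ i, |(w : ι → ℝ) i * f i| := Finset.abs_sum_le_sum_abs _ _
    _ ≤ ∑ i, (w : ι → ℝ) i * c := Finset.sum_le_sum fun i _ => by
        rw [abs_mul, abs_of_nonneg (stdSimplex.zero_le w i)]
        exact mul_le_mul_of_nonneg_left (hf i) (stdSimplex.zero_le w i)
    _ = c := by rw [← Finset.sum_mul, stdSimplex.sum_eq_one, one_mul]

/-- The expected payoff under a plan and a mixed action is bounded by any entrywise bound on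
the payoff matrix. -/
lemma abs_payoff_le {A B : Type*} [Fintype A] [Fintype B] {M : A → B → ℝ} {c : ℝ}
    (hM : ∀ a b, |M a b| ≤ c) (x : B → stdSimplex ℝ A) (y : stdSimplex ℝ B) :
    |∑ b, (y : B → ℝ) b * ∑ a, (x b : A → ℝ) a * M a b| ≤ c :=
  abs_sum_stdSimplex_mul_le y fun b => abs_sum_stdSimplex_mul_le (x b) fun a => hM a b

lemma payoff_le_payoff_add {A B : Type*} [Fintype A] [Fintype B] {M N : A → B → ℝ} {ε : ℝ}
    (h : ∀ a b, |M a b - N a b| ≤ ε) (x : B → stdSimplex ℝ A) (y : stdSimplex ℝ B) :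
    ∑ b, (y : B → ℝ) b * ∑ a, (x b : A → ℝ) a * M a b ≤
      (∑ b, (y : B → ℝ) b * ∑ a, (x b : A → ℝ) a * N a b) + ε := by
  have hd := le_of_abs_le (abs_payoff_le (M := fun a b => M a b - N a b) h x y)
  simp only [mul_sub, Finset.sum_sub_distrib] at hd
  linarith

lemma matrixGameVal_le_add {A B : Type*} [Fintype A] [Fintype B] [Nonempty A] [Nonempty B]
    {M N : A → B → ℝ} {ε : ℝ} (h : ∀ a b, |M a b - N a b| ≤ ε) :
    matrixGameVal M ≤ matrixGameVal N + ε := by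
  have exists_bound (P : A → B → ℝ) : ∃ c, ∀ a b, |P a b| ≤ c := by
    obtain ⟨c, hc⟩ := Set.finite_range (fun p : A × B => |P p.1 p.2|) |>.bddAbove
    exact ⟨c, fun a b => hc ⟨(a, b), rfl⟩⟩
  have bddBelow_payoff (P : A → B → ℝ) (x : B → stdSimplex ℝ A) :
      BddBelow (Set.range fun y : stdSimplex ℝ B =>
        ∑ b, (y : B → ℝ) b * ∑ a, (x b : A → ℝ) a * P a b) := by
    obtain ⟨c, hc⟩ := exists_bound P
    exact ⟨-c, Set.forall_mem_range.2 fun y => neg_le_of_abs_le (abs_payoff_le hc x y)⟩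
  have bddAbove_guarantee : BddAbove (Set.range fun x : B → stdSimplex ℝ A =>
      ⨅ y : stdSimplex ℝ B, ∑ b, (y : B → ℝ) b * ∑ a, (x b : A → ℝ) a * N a b) := by
    obtain ⟨c, hc⟩ := exists_bound N
    let y₀ : stdSimplex ℝ B := Classical.arbitrary _
    exact ⟨c, Set.forall_mem_range.2 fun x =>
      (ciInf_le (bddBelow_payoff N x) y₀).trans (le_of_abs_le (abs_payoff_le hc x y₀))⟩
  refine ciSup_le fun x => ?_
  refine le_trans ?_ (add_le_add_left (le_ciSup bddAbove_guarantee x) ε)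
  rw [← sub_le_iff_le_add]
  refine le_ciInf fun y => sub_le_iff_le_add.2 ?_
  exact (ciInf_le (bddBelow_payoff M x) y).trans (payoff_le_payoff_add h x y)

/-- Nonexpansiveness of the matrix-game value: if the payoff matrices `M` and
`N` differ entrywise by at most `ε ≥ 0`, then their game values differ by at
most `ε`. -/
theorem matrixGameVal_nonexpansive
    {A B : Type*} [Fintype A] [Fintype B] [Nonempty A] [Nonempty B]
    (M N : A → B → ℝ) (ε : ℝ) (hε : 0 ≤ ε)
    (h : ∀ a b, |M a b - N a b| ≤ ε) :
    |matrixGameVal M - matrixGameVal N| ≤ ε := by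
  have hMN := matrixGameVal_le_add h
  have hNM := matrixGameVal_le_add fun a b => (abs_sub_comm (N a b) (M a b)).trans_le (h a b)
  exact abs_sub_le_iff.2 ⟨by linarith, by linarith⟩
end

section
/- (Proposition 4.1, Contraction mapping.) In an MG-SPA, the minimax Bellman operator L is a γ-contraction on the space S → ℝ equipped with the supremum metric: for all u, v : S → ℝ, dist (L u) (L v) ≤ γ · dist u v; equivalently, |（L u)(s) − (L v)(s)| ≤ γ · (⨆_{s'} |u s' − v s'|) for every s ∈ S. -/
open scoped BigOperators

section MGSPA

variable {S A B : Type*}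

/-- The induced one-step expected reward of the joint policy `(π, ρ)`:
`r_{π,ρ}(s) = ∑ b, (ρ s) b * ∑ a, (π s b) a * r s a b`. -/
noncomputable def rPol [Fintype A] [Fintype B]
    (r : S → A → B → ℝ)
    (π : S → B → stdSimplex ℝ A) (ρ : S → stdSimplex ℝ B) : S → ℝ :=
  fun s => ∑ b, (ρ s : B → ℝ) b * ∑ a, (π s b : A → ℝ) a * r s a b

/-- The induced state-transition matrix of the joint policy `(π, ρ)`:
`P_{π,ρ}(s, s') = ∑ b, (ρ s) b * ∑ a, (π s b) a * p s a b s'`. -/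
noncomputable def PPol [Fintype A] [Fintype B]
    (p : S → A → B → S → ℝ)
    (π : S → B → stdSimplex ℝ A) (ρ : S → stdSimplex ℝ B) : Matrix S S ℝ :=
  fun s s' => ∑ b, (ρ s : B → ℝ) b * ∑ a, (π s b : A → ℝ) a * p s a b s'

/-- The value function of the joint policy `(π, ρ)`:
`v_{π,ρ}(s) = ∑' t, γ^t * ((P_{π,ρ}^t) *ᵥ r_{π,ρ}) s`. -/
noncomputable def vFn [Fintype S] [DecidableEq S] [Fintype A] [Fintype B]
    (γ : ℝ) (r : S → A → B → ℝ) (p : S → A → B → S → ℝ)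
    (π : S → B → stdSimplex ℝ A) (ρ : S → stdSimplex ℝ B) : S → ℝ :=
  fun s => ∑' t : ℕ, γ ^ t * (((PPol p π ρ) ^ t).mulVec (rPol r π ρ)) s

/-- The minimax (Shapley) Bellman operator of the MG-SPA. -/
noncomputable def Lop [Fintype S] [Fintype A] [Fintype B]
    (γ : ℝ) (r : S → A → B → ℝ) (p : S → A → B → S → ℝ)
    (v : S → ℝ) : S → ℝ :=
  fun s => ⨆ x : B → stdSimplex ℝ A, ⨅ y : stdSimplex ℝ B,
    ∑ b, (y : B → ℝ) b * ∑ a, (x b : A → ℝ) a *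
      (r s a b + γ * ∑ s', p s a b s' * v s')

end MGSPA

/-- The expected payoff of a matrix game `f` when the second player mixes with `y` and the first
player answers the column `b` with the mixed action `x b`. -/
noncomputable def mixedPayoff {A B : Type*} [Fintype A] [Fintype B] (f : A → B → ℝ)
    (x : B → stdSimplex ℝ A) (y : stdSimplex ℝ B) : ℝ :=
  ∑ b, (y : B → ℝ) b * ∑ a, (x b : A → ℝ) a * f a b

section MixedPayoff

variable {A B : Type*} [Fintype A] [Fintype B]

theorem mixedPayoff_mono {f g : A → B → ℝ} (h : ∀ a b, f a b ≤ g a b)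
    (x : B → stdSimplex ℝ A) (y : stdSimplex ℝ B) : mixedPayoff f x y ≤ mixedPayoff g x y :=
  Finset.sum_le_sum fun b _ => mul_le_mul_of_nonneg_left
    (Finset.sum_le_sum fun a _ => mul_le_mul_of_nonneg_left (h a b) ((x b).2.1 a)) (y.2.1 b)

theorem mixedPayoff_add_const (f : A → B → ℝ) (c : ℝ)
    (x : B → stdSimplex ℝ A) (y : stdSimplex ℝ B) :
    mixedPayoff (fun a b => f a b + c) x y = mixedPayoff f x y + c := by
  have hx (b : B) : ∑ a, (x b : A → ℝ) a = 1 := (x b).2.2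
  have hy : ∑ b, (y : B → ℝ) b = 1 := y.2.2
  simp only [mixedPayoff, mul_add, Finset.sum_add_distrib, ← Finset.sum_mul, hx, hy, one_mul]

theorem exists_abs_mixedPayoff_le (f : A → B → ℝ) :
    ∃ C, ∀ x y, |mixedPayoff f x y| ≤ C := by
  obtain ⟨C, hC⟩ := (Set.finite_range fun q : A × B => |f q.1 q.2|).bddAbove
  have hf (a : A) (b : B) : |f a b| ≤ C := hC ⟨(a, b), rfl⟩
  have hconst (c : ℝ) (x : B → stdSimplex ℝ A) (y : stdSimplex ℝ B) :
      mixedPayoff (fun _ _ => c) x y = c := by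
    simpa [mixedPayoff] using mixedPayoff_add_const (fun _ _ => 0) c x y
  refine ⟨C, fun x y => abs_le.2 ⟨?_, ?_⟩⟩
  · rw [← hconst (-C) x y]
    exact mixedPayoff_mono (fun a b => (abs_le.1 (hf a b)).1) x y
  · rw [← hconst C x y]
    exact mixedPayoff_mono (fun a b => (abs_le.1 (hf a b)).2) x y

theorem iSup_iInf_mixedPayoff_le_add [Nonempty A] [Nonempty B] {f g : A → B → ℝ} {c : ℝ}
    (h : ∀ a b, f a b ≤ g a b + c) :
    ⨆ x, ⨅ y, mixedPayoff f x y ≤ (⨆ x, ⨅ y, mixedPayoff g x y) + c := by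
  obtain ⟨C, hC⟩ := exists_abs_mixedPayoff_le f
  obtain ⟨K, hK⟩ := exists_abs_mixedPayoff_le g
  have hf (x : B → stdSimplex ℝ A) : BddBelow (Set.range (mixedPayoff f x)) :=
    ⟨-C, Set.forall_mem_range.2 fun y => (abs_le.1 (hC x y)).1⟩
  have hg (x : B → stdSimplex ℝ A) : BddBelow (Set.range (mixedPayoff g x)) :=
    ⟨-K, Set.forall_mem_range.2 fun y => (abs_le.1 (hK x y)).1⟩
  have hsup : BddAbove (Set.range fun x => ⨅ y, mixedPayoff g x y) :=
    ⟨K, Set.forall_mem_range.2 fun x =>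
      (ciInf_le (hg x) (Classical.arbitrary _)).trans (abs_le.1 (hK x _)).2⟩
  refine ciSup_le fun x => ?_
  have hinf : (⨅ y, mixedPayoff f x y) - c ≤ ⨅ y, mixedPayoff g x y := by
    refine le_ciInf fun y => ?_
    have hxy := mixedPayoff_mono h x y
    rw [mixedPayoff_add_const] at hxy
    linarith [ciInf_le (hf x) y]
  linarith [le_ciSup hsup x]

end MixedPayoff

theorem Lop_le_add {S A B : Type*} [Fintype S] [Fintype A] [Nonempty A] [Fintype B] [Nonempty B]
    {γ : ℝ} (hγ0 : 0 ≤ γ) (r : S → A → B → ℝ) {p : S → A → B → S → ℝ}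
    (hp0 : ∀ s a b s', 0 ≤ p s a b s') (hp1 : ∀ s a b, ∑ s', p s a b s' = 1)
    {u v : S → ℝ} {d : ℝ} (h : ∀ s, u s ≤ v s + d) (s : S) :
    Lop γ r p u s ≤ Lop γ r p v s + γ * d := by
  refine iSup_iInf_mixedPayoff_le_add fun a b => ?_
  have hsum : ∑ s', p s a b s' * u s' ≤ ∑ s', p s a b s' * v s' + d := by
    calc ∑ s', p s a b s' * u s' ≤ ∑ s', p s a b s' * (v s' + d) :=
          Finset.sum_le_sum fun s' _ => mul_le_mul_of_nonneg_left (h s') (hp0 s a b s')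
      _ = ∑ s', p s a b s' * v s' + d := by
          simp only [mul_add, Finset.sum_add_distrib, ← Finset.sum_mul, hp1, one_mul]
  linarith [mul_le_mul_of_nonneg_left hsum hγ0]

theorem abs_Lop_sub_le {S A B : Type*} [Fintype S] [Fintype A] [Nonempty A] [Fintype B]
    [Nonempty B] {γ : ℝ} (hγ0 : 0 ≤ γ) (r : S → A → B → ℝ) {p : S → A → B → S → ℝ}
    (hp0 : ∀ s a b s', 0 ≤ p s a b s') (hp1 : ∀ s a b, ∑ s', p s a b s' = 1)
    {u v : S → ℝ} {d : ℝ} (h : ∀ s, |u s - v s| ≤ d) (s : S) :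
    |Lop γ r p u s - Lop γ r p v s| ≤ γ * d := by
  have huv := Lop_le_add hγ0 r hp0 hp1 (u := u) (v := v) (d := d)
    (fun s' => by linarith [(abs_le.1 (h s')).2]) s
  have hvu := Lop_le_add hγ0 r hp0 hp1 (u := v) (v := u) (d := d)
    (fun s' => by linarith [(abs_le.1 (h s')).1]) s
  exact abs_le.2 ⟨by linarith, by linarith⟩

/-- (Proposition 4.1, Contraction mapping.)  The minimax Bellman operator `L`
is a `γ`-contraction on `S → ℝ` with the supremum metric; equivalently,
pointwise, `|L u s - L v s| ≤ γ * ⨆ s', |u s' - v s'|`. -/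
theorem Lop_contraction
    {S A B : Type*} [Fintype S] [DecidableEq S] [Nonempty S]
    [Fintype A] [Nonempty A] [Fintype B] [Nonempty B]
    (γ : ℝ) (hγ0 : 0 ≤ γ) (hγ1 : γ < 1)
    (r : S → A → B → ℝ) (p : S → A → B → S → ℝ)
    (hp0 : ∀ s a b s', 0 ≤ p s a b s')
    (hp1 : ∀ s a b, ∑ s', p s a b s' = 1) :
    (∀ u v : S → ℝ, dist (Lop γ r p u) (Lop γ r p v) ≤ γ * dist u v) ∧
    (∀ u v : S → ℝ, ∀ s : S,
      |Lop γ r p u s - Lop γ r p v s| ≤ γ * ⨆ s', |u s' - v s'|) := by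
  refine ⟨fun u v => ?_, fun u v s => ?_⟩
  · refine (dist_pi_le_iff (mul_nonneg hγ0 dist_nonneg)).2 fun s => ?_
    exact abs_Lop_sub_le hγ0 r hp0 hp1 (fun s' => dist_le_pi_dist u v s') s
  · exact abs_Lop_sub_le hγ0 r hp0 hp1
      (fun s' => le_ciSup (f := fun s' => |u s' - v s'|) (Set.finite_range _).bddAbove s') s
end

section
/- (Lemma A.2, attainment of the minimax in the Bellman operator.) In an MG-SPA, for every v : S → ℝ there exist an agent policy π : S → (B → stdSimplex ℝ A) and an adversary policy ρ : S → stdSimplex ℝ B such that for every s ∈ S: (L v)(s) = r_{π,ρ}(s) + γ · ∑_{s' ∈ S} P_{π,ρ}(s, s') · v(s'). -/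
open scoped BigOperators

/-- A finite zero-sum game in which the maximizer observes the minimizer's action has its
max-min value attained by a pair of strategies. -/
theorem exists_eq_iSup_iInf_observed {A B : Type*} [Fintype A] [Nonempty A] [Fintype B]
    [Nonempty B] (c : A → B → ℝ) :
    ∃ (x : B → stdSimplex ℝ A) (y : stdSimplex ℝ B),
      (⨆ x : B → stdSimplex ℝ A, ⨅ y : stdSimplex ℝ B,
        ∑ b, (y : B → ℝ) b * ∑ a, (x b : A → ℝ) a * c a b) =
      ∑ b, (y : B → ℝ) b * ∑ a, (x b : A → ℝ) a * c a b := by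
  classical
  choose f hf using fun b => Finite.exists_max fun a => c a b
  obtain ⟨b₀, hb₀⟩ := Finite.exists_min fun b => c (f b) b
  let x₀ : B → stdSimplex ℝ A := fun b => ⟨Pi.single (f b) 1, single_mem_stdSimplex ℝ (f b)⟩
  let y₀ : stdSimplex ℝ B := ⟨Pi.single b₀ 1, single_mem_stdSimplex ℝ b₀⟩
  have : Nonempty (stdSimplex ℝ A) := ⟨x₀ b₀⟩
  have : Nonempty (stdSimplex ℝ B) := ⟨y₀⟩
  have : CompactSpace (stdSimplex ℝ B) := isCompact_iff_compactSpace.mp (isCompact_stdSimplex ℝ B)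
  have hx₀ (b : B) : ∑ a, (x₀ b : A → ℝ) a * c a b = c (f b) b := by
    simp [x₀, Pi.single_apply]
  have hy₀ (g : B → ℝ) : ∑ b, (y₀ : B → ℝ) b * g b = g b₀ := by
    simp [y₀, Pi.single_apply]
  have hle (x : B → stdSimplex ℝ A) : (⨅ y : stdSimplex ℝ B,
      ∑ b, (y : B → ℝ) b * ∑ a, (x b : A → ℝ) a * c a b) ≤ c (f b₀) b₀ := by
    have hbdd : BddBelow (Set.range fun y : stdSimplex ℝ B =>
        ∑ b, (y : B → ℝ) b * ∑ a, (x b : A → ℝ) a * c a b) := by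
      refine (isCompact_range ?_).bddBelow
      exact continuous_finsetSum _ fun b _ =>
        ((continuous_apply b).comp continuous_subtype_val).mul continuous_const
    refine (ciInf_le hbdd y₀).trans ?_
    rw [hy₀]
    calc ∑ a, (x b₀ : A → ℝ) a * c a b₀
        ≤ ∑ a, (x b₀ : A → ℝ) a * c (f b₀) b₀ :=
          Finset.sum_le_sum fun a _ => mul_le_mul_of_nonneg_left (hf b₀ a) ((x b₀).2.1 a)
      _ = c (f b₀) b₀ := by rw [← Finset.sum_mul, stdSimplex.sum_eq_one, one_mul]
  refine ⟨x₀, y₀, ?_⟩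
  rw [hy₀, hx₀]
  refine le_antisymm (ciSup_le hle) (le_ciSup_of_le ⟨_, Set.forall_mem_range.2 hle⟩ x₀ ?_)
  refine le_ciInf fun y => ?_
  simp only [hx₀]
  calc c (f b₀) b₀ = ∑ b, (y : B → ℝ) b * c (f b₀) b₀ := by
        rw [← Finset.sum_mul, stdSimplex.sum_eq_one, one_mul]
    _ ≤ ∑ b, (y : B → ℝ) b * c (f b) b :=
        Finset.sum_le_sum fun b _ => mul_le_mul_of_nonneg_left (hb₀ b) (y.2.1 b)

/-- The one-step lookahead value of a joint policy, in terms of its reward and transitions. -/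
theorem rPol_add_mul_sum_PPol {S A B : Type*} [Fintype S] [Fintype A] [Fintype B]
    (γ : ℝ) (r : S → A → B → ℝ) (p : S → A → B → S → ℝ) (v : S → ℝ)
    (π : S → B → stdSimplex ℝ A) (ρ : S → stdSimplex ℝ B) (s : S) :
    rPol r π ρ s + γ * ∑ s', PPol p π ρ s s' * v s' =
      ∑ b, (ρ s : B → ℝ) b * ∑ a, (π s b : A → ℝ) a *
        (r s a b + γ * ∑ s', p s a b s' * v s') := by
  have h : ∑ s', PPol p π ρ s s' * v s' =
      ∑ b, (ρ s : B → ℝ) b * ∑ a, (π s b : A → ℝ) a * ∑ s', p s a b s' * v s' := by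
    simp only [PPol, Finset.sum_mul, Finset.mul_sum]
    rw [Finset.sum_comm]
    refine Finset.sum_congr rfl fun b _ => ?_
    rw [Finset.sum_comm]
    exact Finset.sum_congr rfl fun a _ => Finset.sum_congr rfl fun s' _ => by ring
  simp only [h, rPol, mul_add, Finset.sum_add_distrib]
  congr 1
  simp only [Finset.mul_sum, mul_left_comm γ]

/-- (Lemma A.2, attainment of the minimax in the Bellman operator.)
For every `v : S → ℝ` there exist stationary policies `π, ρ` attaining the
minimax Bellman operator: `(L v)(s) = r_{π,ρ}(s) + γ * ∑ s', P_{π,ρ}(s,s') * v s'`. -/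
theorem Lop_attained_by_policies
    {S A B : Type*} [Fintype S] [DecidableEq S] [Nonempty S]
    [Fintype A] [Nonempty A] [Fintype B] [Nonempty B]
    (γ : ℝ) (hγ0 : 0 ≤ γ) (hγ1 : γ < 1)
    (r : S → A → B → ℝ) (p : S → A → B → S → ℝ)
    (hp0 : ∀ s a b s', 0 ≤ p s a b s')
    (hp1 : ∀ s a b, ∑ s', p s a b s' = 1)
    (v : S → ℝ) :
    ∃ (π : S → B → stdSimplex ℝ A) (ρ : S → stdSimplex ℝ B),
      ∀ s : S, Lop γ r p v s = rPol r π ρ s + γ * ∑ s', PPol p π ρ s s' * v s' := by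
  choose π ρ h using fun s =>
    exists_eq_iSup_iInf_observed fun a b => r s a b + γ * ∑ s', p s a b s' * v s'
  refine ⟨π, ρ, fun s => ?_⟩
  rw [rPol_add_mul_sum_PPol]
  exact h s
end

section
/- In an MG-SPA, if v : S → ℝ satisfies v(s) ≤ (L v)(s) for every s ∈ S, then v(s) ≤ ⨆_{π} ⨅_{ρ} v_{π,ρ}(s) for every s ∈ S, where the supremum is over all agent policies π : S → (B → stdSimplex ℝ A) and the infimum is over all adversary policies ρ : S → stdSimplex ℝ B. (The second half of the proof of Theorem 4.4-(1).) -/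
open scoped BigOperators

/-- An average of values bounded by `C` in absolute value is bounded by `C`. -/
theorem abs_sum_mul_le_of_mem_stdSimplex {X : Type*} [Fintype X] {w f : X → ℝ} {C : ℝ}
    (hw : w ∈ stdSimplex ℝ X) (hf : ∀ x, |f x| ≤ C) : |∑ x, w x * f x| ≤ C :=
  calc |∑ x, w x * f x| ≤ ∑ x, |w x * f x| := Finset.abs_sum_le_sum_abs _ _
    _ ≤ ∑ x, w x * C := Finset.sum_le_sum fun x _ => by
        rw [abs_mul, abs_of_nonneg (hw.1 x)]
        exact mul_le_mul_of_nonneg_left (hf x) (hw.1 x)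
    _ = C := by rw [← Finset.sum_mul, hw.2, one_mul]

/-- An average over both actions is bounded by the sup norm of the averaged array. -/
theorem abs_sum_mul_sum_mul_le_norm {A B : Type*} [Fintype A] [Fintype B]
    (x : B → stdSimplex ℝ A) (y : stdSimplex ℝ B) (q : A → B → ℝ) :
    |∑ b, (y : B → ℝ) b * ∑ a, (x b : A → ℝ) a * q a b| ≤ ‖q‖ :=
  abs_sum_mul_le_of_mem_stdSimplex y.2 fun b =>
    abs_sum_mul_le_of_mem_stdSimplex (x b).2 fun a =>
      (norm_le_pi_norm (q a) b).trans (norm_le_pi_norm q a)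

section MGSPA

variable {S A B : Type*} [Fintype S] [Fintype A] [Fintype B]

/-- The one-step backup of `v` under `(π, ρ)`, in the form used by `Lop`. -/
theorem sum_mul_sum_mul_add_eq (γ : ℝ) (r : S → A → B → ℝ) (p : S → A → B → S → ℝ)
    (π : S → B → stdSimplex ℝ A) (ρ : S → stdSimplex ℝ B) (v : S → ℝ) (s : S) :
    ∑ b, (ρ s : B → ℝ) b * ∑ a, (π s b : A → ℝ) a * (r s a b + γ * ∑ s', p s a b s' * v s') =
      rPol r π ρ s + γ * (PPol p π ρ).mulVec v s := by
  have hP : (PPol p π ρ).mulVec v s =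
      ∑ b, (ρ s : B → ℝ) b * ∑ a, (π s b : A → ℝ) a * ∑ s', p s a b s' * v s' := by
    simp only [Matrix.mulVec, dotProduct, PPol, Finset.sum_mul, Finset.mul_sum]
    rw [Finset.sum_comm]
    refine Finset.sum_congr rfl fun b _ => ?_
    rw [Finset.sum_comm]
    simp only [mul_assoc]
  rw [hP, rPol, Finset.mul_sum, ← Finset.sum_add_distrib]
  refine Finset.sum_congr rfl fun b _ => ?_
  rw [mul_left_comm, ← mul_add]
  congr 1
  rw [Finset.mul_sum, ← Finset.sum_add_distrib]
  exact Finset.sum_congr rfl fun a _ => by ring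

variable [DecidableEq S]

theorem abs_mulVec_le_of_mem_rowStochastic {M : Matrix S S ℝ}
    (hM : M ∈ Matrix.rowStochastic ℝ S) {u : S → ℝ} {C : ℝ} (hu : ∀ s, |u s| ≤ C) (s : S) :
    |M.mulVec u s| ≤ C :=
  abs_sum_mul_le_of_mem_stdSimplex
    ⟨fun _ => Matrix.nonneg_of_mem_rowStochastic hM,
      Matrix.sum_row_of_mem_rowStochastic hM s⟩ hu

theorem PPol_mem_rowStochastic {p : S → A → B → S → ℝ} (hp0 : ∀ s a b s', 0 ≤ p s a b s')
    (hp1 : ∀ s a b, ∑ s', p s a b s' = 1)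
    (π : S → B → stdSimplex ℝ A) (ρ : S → stdSimplex ℝ B) :
    PPol p π ρ ∈ Matrix.rowStochastic ℝ S := by
  rw [Matrix.mem_rowStochastic_iff_sum]
  refine ⟨fun s s' => Finset.sum_nonneg fun b _ => mul_nonneg ((ρ s).2.1 b) <|
    Finset.sum_nonneg fun a _ => mul_nonneg ((π s b).2.1 a) (hp0 s a b s'), fun s => ?_⟩
  simp only [PPol]
  rw [Finset.sum_comm]
  simp_rw [← Finset.mul_sum]
  refine (Finset.sum_congr rfl fun b _ => ?_).trans (ρ s).2.2
  rw [Finset.sum_comm]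
  simp_rw [← Finset.mul_sum, hp1, mul_one]
  exact (congrArg _ (π s b).2.2).trans (mul_one _)

/-- The discounted iterates of a row-stochastic matrix are geometrically bounded. -/
theorem norm_pow_mul_pow_mulVec_le {γ : ℝ} (hγ0 : 0 ≤ γ) {M : Matrix S S ℝ}
    (hM : M ∈ Matrix.rowStochastic ℝ S) {u : S → ℝ} {C : ℝ} (hu : ∀ s, |u s| ≤ C)
    (s : S) (t : ℕ) : ‖γ ^ t * (M ^ t).mulVec u s‖ ≤ γ ^ t * C := by
  rw [Real.norm_eq_abs, abs_mul, abs_of_nonneg (pow_nonneg hγ0 t)]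
  exact mul_le_mul_of_nonneg_left
    (abs_mulVec_le_of_mem_rowStochastic (pow_mem hM t) hu s) (pow_nonneg hγ0 t)

theorem summable_pow_mul_pow_mulVec {γ : ℝ} (hγ0 : 0 ≤ γ) (hγ1 : γ < 1) {M : Matrix S S ℝ}
    (hM : M ∈ Matrix.rowStochastic ℝ S) (u : S → ℝ) (s : S) :
    Summable fun t : ℕ => γ ^ t * (M ^ t).mulVec u s :=
  .of_norm_bounded ((summable_geometric_of_lt_one hγ0 hγ1).mul_right ‖u‖)
    (norm_pow_mul_pow_mulVec_le hγ0 hM (norm_le_pi_norm u) s)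

theorem abs_vFn_le {γ : ℝ} (hγ0 : 0 ≤ γ) (hγ1 : γ < 1) (r : S → A → B → ℝ)
    {p : S → A → B → S → ℝ} (hp0 : ∀ s a b s', 0 ≤ p s a b s')
    (hp1 : ∀ s a b, ∑ s', p s a b s' = 1)
    (π : S → B → stdSimplex ℝ A) (ρ : S → stdSimplex ℝ B) (s : S) :
    |vFn γ r p π ρ s| ≤ (1 - γ)⁻¹ * ‖r‖ :=
  tsum_of_norm_bounded ((hasSum_geometric_of_lt_one hγ0 hγ1).mul_right ‖r‖)
    (norm_pow_mul_pow_mulVec_le hγ0 (PPol_mem_rowStochastic hp0 hp1 π ρ)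
      (fun s => (abs_sum_mul_sum_mul_le_norm (π s) (ρ s) (r s)).trans (norm_le_pi_norm r s)) s)

/-- If `v ≤ u + γ M v + ε` with `M` row-stochastic, then `v` is at most the discounted sum of `u`
along `M`, up to `ε / (1 - γ)`. -/
theorem le_tsum_of_le_add_mulVec {γ : ℝ} (hγ0 : 0 ≤ γ) (hγ1 : γ < 1) {M : Matrix S S ℝ}
    (hM : M ∈ Matrix.rowStochastic ℝ S) {u v : S → ℝ} {ε : ℝ}
    (h : ∀ s, v s ≤ u s + γ * M.mulVec v s + ε) (s : S) :
    v s ≤ ∑' t : ℕ, γ ^ t * (M ^ t).mulVec u s + (1 - γ)⁻¹ * ε := by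
  have hv := summable_pow_mul_pow_mulVec hγ0 hγ1 hM v s
  have hu := summable_pow_mul_pow_mulVec hγ0 hγ1 hM u s
  have hg := (hasSum_geometric_of_lt_one hγ0 hγ1).mul_right ε
  have hstep (t : ℕ) : γ ^ t * (M ^ t).mulVec v s ≤
      γ ^ t * (M ^ t).mulVec u s + γ ^ t * ε + γ ^ (t + 1) * (M ^ (t + 1)).mulVec v s := by
    have hMt := pow_mem hM t
    have hmono : (M ^ t).mulVec v s ≤
        (M ^ t).mulVec (u + γ • M.mulVec v + fun _ => ε) s :=
      Finset.sum_le_sum fun s' _ =>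
        mul_le_mul_of_nonneg_left (h s') (Matrix.nonneg_of_mem_rowStochastic hMt)
    have hconst : (M ^ t).mulVec (fun _ => ε) s = ε := by
      simp only [Matrix.mulVec, dotProduct]
      rw [← Finset.sum_mul, Matrix.sum_row_of_mem_rowStochastic hMt, one_mul]
    rw [Matrix.mulVec_add, Matrix.mulVec_add, Matrix.mulVec_smul, Matrix.mulVec_mulVec,
      ← pow_succ, Pi.add_apply, Pi.add_apply, hconst, Pi.smul_apply, smul_eq_mul] at hmono
    calc _ ≤ _ := mul_le_mul_of_nonneg_left hmono (pow_nonneg hγ0 t)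
      _ = _ := by ring
  have hv' := (summable_nat_add_iff 1).2 hv
  have hle := hv.tsum_le_tsum hstep ((hu.add hg.summable).add hv')
  rw [(hu.add hg.summable).tsum_add hv', hu.tsum_add hg.summable, hg.tsum_eq,
    hv.tsum_eq_zero_add] at hle
  simpa using hle

end MGSPA

/-- (Second half of the proof of Theorem 4.4-(1).)  If `v ≤ L v` pointwise,
then `v` is dominated by the sup-inf value: `v s ≤ ⨆ π, ⨅ ρ, v_{π,ρ}(s)`. -/
theorem le_Lop_implies_le_optimal
    {S A B : Type*} [Fintype S] [DecidableEq S] [Nonempty S]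
    [Fintype A] [Nonempty A] [Fintype B] [Nonempty B]
    (γ : ℝ) (hγ0 : 0 ≤ γ) (hγ1 : γ < 1)
    (r : S → A → B → ℝ) (p : S → A → B → S → ℝ)
    (hp0 : ∀ s a b s', 0 ≤ p s a b s')
    (hp1 : ∀ s a b, ∑ s', p s a b s' = 1)
    (v : S → ℝ) (hv : ∀ s, v s ≤ Lop γ r p v s) :
    ∀ s : S,
      v s ≤
        ⨆ π : S → B → stdSimplex ℝ A, ⨅ ρ : S → stdSimplex ℝ B, vFn γ r p π ρ s := by
  intro s
  have hbelow (π : S → B → stdSimplex ℝ A) :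
      BddBelow (Set.range fun ρ : S → stdSimplex ℝ B => vFn γ r p π ρ s) :=
    ⟨-((1 - γ)⁻¹ * ‖r‖), Set.forall_mem_range.2 fun ρ =>
      (abs_le.1 (abs_vFn_le hγ0 hγ1 r hp0 hp1 π ρ s)).1⟩
  have habove : BddAbove (Set.range fun π : S → B → stdSimplex ℝ A =>
      ⨅ ρ : S → stdSimplex ℝ B, vFn γ r p π ρ s) :=
    ⟨(1 - γ)⁻¹ * ‖r‖, Set.forall_mem_range.2 fun π =>
      (ciInf_le (hbelow π) (Classical.arbitrary _)).trans
        (abs_le.1 (abs_vFn_le hγ0 hγ1 r hp0 hp1 π _ s)).2⟩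
  refine le_of_forall_pos_le_add fun δ hδ => ?_
  have hγ : 0 < 1 - γ := sub_pos.2 hγ1
  have hε : 0 < (1 - γ) * δ := mul_pos hγ hδ
  choose π hπ using fun s => exists_lt_of_lt_ciSup ((sub_lt_self (v s) hε).trans_le (hv s))
  rw [← sub_le_iff_le_add]
  refine le_trans (le_ciInf fun ρ => ?_) (le_ciSup habove π)
  have hstep (s : S) :
      v s ≤ rPol r π ρ s + γ * (PPol p π ρ).mulVec v s + (1 - γ) * δ := by
    rw [← sub_le_iff_le_add, ← sum_mul_sum_mul_add_eq]
    let q : A → B → ℝ := fun a b => r s a b + γ * ∑ s', p s a b s' * v s'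
    exact (hπ s).le.trans (ciInf_le ⟨-‖q‖, Set.forall_mem_range.2 fun y =>
      (abs_le.1 (abs_sum_mul_sum_mul_le_norm (π s) y q)).1⟩ (ρ s))
  have hle := le_tsum_of_le_add_mulVec hγ0 hγ1 (PPol_mem_rowStochastic hp0 hp1 π ρ) hstep s
  rw [inv_mul_cancel_left₀ hγ.ne'] at hle
  exact sub_le_iff_le_add.2 hle
end

section
/- (Theorem 4.4-(3), robust equilibrium satisfies the Bellman equation.) In an MG-SPA, if (π*, ρ*) is a robust equilibrium, then its value function satisfies the Bellman optimality equation: L v_{π*,ρ*} = v_{π*,ρ*}, i.e., v_{π*,ρ*}(s) = ⨆_{x : B → stdSimplex ℝ A} ⨅_{y ∈ stdSimplex ℝ B} ∑_{b} y b · ∑_{a} (x b) a · (r s a b + γ · ∑_{s'} p s a b s' · v_{π*,ρ*}(s')) for every s ∈ S. -/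
open scoped BigOperators

section MGSPA

variable {S A B : Type*}

section StochasticMatrix

variable [Fintype S] {P : Matrix S S ℝ}

/-- A row average under a stochastic matrix of a function bounded below by `c` is at least `c`. -/
lemma le_mulVec_of_stochastic (hP0 : ∀ i j, 0 ≤ P i j) (hP1 : ∀ i, ∑ j, P i j = 1)
    {f : S → ℝ} {c : ℝ} (hf : ∀ s, c ≤ f s) (s : S) : c ≤ P.mulVec f s := by
  calc c = ∑ j, P s j * c := by rw [← Finset.sum_mul, hP1, one_mul]
    _ ≤ ∑ j, P s j * f j :=
      Finset.sum_le_sum fun j _ => mul_le_mul_of_nonneg_left (hf j) (hP0 s j)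

lemma abs_pow_mulVec_le_of_stochastic [DecidableEq S]
    (hP0 : ∀ i j, 0 ≤ P i j) (hP1 : ∀ i, ∑ j, P i j = 1)
    {f : S → ℝ} {C : ℝ} (hf : ∀ s, |f s| ≤ C) (t : ℕ) (s : S) :
    |(P ^ t).mulVec f s| ≤ C := by
  induction t generalizing s with
  | zero => simpa using hf s
  | succ t ih =>
    rw [pow_succ', ← Matrix.mulVec_mulVec]
    refine abs_le.2 ⟨le_mulVec_of_stochastic hP0 hP1 (fun s' => (abs_le.1 (ih s')).1) s, ?_⟩
    have h := le_mulVec_of_stochastic hP0 hP1 (f := -(P ^ t).mulVec f) (c := -C)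
      (fun s' => neg_le_neg (abs_le.1 (ih s')).2) s
    rw [Matrix.mulVec_neg] at h
    exact neg_le_neg_iff.1 h

lemma summable_discounted_of_stochastic [DecidableEq S]
    (hP0 : ∀ i j, 0 ≤ P i j) (hP1 : ∀ i, ∑ j, P i j = 1)
    {γ : ℝ} (hγ0 : 0 ≤ γ) (hγ1 : γ < 1) (f : S → ℝ) (s : S) :
    Summable fun t : ℕ => γ ^ t * (P ^ t).mulVec f s := by
  have hf : ∀ s, |f s| ≤ ∑ s', |f s'| := fun s =>
    Finset.single_le_sum (f := fun s' => |f s'|) (fun _ _ => abs_nonneg _) (Finset.mem_univ s)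
  refine Summable.of_norm_bounded
    ((summable_geometric_of_lt_one hγ0 hγ1).mul_right (∑ s', |f s'|)) fun t => ?_
  rw [Real.norm_eq_abs, abs_mul, abs_of_nonneg (pow_nonneg hγ0 t)]
  exact mul_le_mul_of_nonneg_left (abs_pow_mulVec_le_of_stochastic hP0 hP1 hf t s)
    (pow_nonneg hγ0 t)

lemma tsum_discounted_eq_of_stochastic [DecidableEq S]
    (hP0 : ∀ i j, 0 ≤ P i j) (hP1 : ∀ i, ∑ j, P i j = 1)
    {γ : ℝ} (hγ0 : 0 ≤ γ) (hγ1 : γ < 1) (f : S → ℝ) (s : S) :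
    ∑' t : ℕ, γ ^ t * (P ^ t).mulVec f s =
      f s + γ * P.mulVec (fun s' => ∑' t : ℕ, γ ^ t * (P ^ t).mulVec f s') s := by
  have hsum := summable_discounted_of_stochastic hP0 hP1 hγ0 hγ1 f
  rw [(hsum s).tsum_eq_zero_add]
  congr 1
  · simp
  · simp only [Matrix.mulVec, dotProduct, ← tsum_mul_left] at hsum ⊢
    rw [← Summable.tsum_finsetSum fun j _ => (hsum j).mul_left _, ← tsum_mul_left]
    refine tsum_congr fun t => ?_
    have h : (P ^ (t + 1)).mulVec f s = ∑ j, P s j * (P ^ t).mulVec f j := by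
      rw [pow_succ', ← Matrix.mulVec_mulVec]; rfl
    simp only [Matrix.mulVec, dotProduct] at h
    rw [h, Finset.mul_sum, Finset.mul_sum]
    exact Finset.sum_congr rfl fun j _ => by ring

/-- Minimum principle for the discounted operator `1 - γ P`. -/
lemma nonneg_of_discounted_mulVec_le [Nonempty S]
    (hP0 : ∀ i j, 0 ≤ P i j) (hP1 : ∀ i, ∑ j, P i j = 1)
    {γ : ℝ} (hγ0 : 0 ≤ γ) (hγ1 : γ < 1) {e : S → ℝ}
    (he : ∀ s, γ * P.mulVec e s ≤ e s) (s : S) : 0 ≤ e s := by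
  obtain ⟨m, hm⟩ := Finite.exists_min e
  have h := mul_le_mul_of_nonneg_left (le_mulVec_of_stochastic hP0 hP1 hm m) hγ0
  have : 0 ≤ e m := by nlinarith [he m]
  exact this.trans (hm s)

end StochasticMatrix

section Policy

variable [Fintype A] [Fintype B] {p : S → A → B → S → ℝ}

lemma PPol_nonneg (hp0 : ∀ s a b s', 0 ≤ p s a b s')
    (π : S → B → stdSimplex ℝ A) (ρ : S → stdSimplex ℝ B) (s s' : S) :
    0 ≤ PPol p π ρ s s' :=
  Finset.sum_nonneg fun b _ => mul_nonneg ((ρ s).2.1 b) <|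
    Finset.sum_nonneg fun a _ => mul_nonneg ((π s b).2.1 a) (hp0 s a b s')

/-- The one-step payoff against the continuation value `v`, the objective inside `Lop`. -/
noncomputable def qFn [Fintype S] (γ : ℝ) (r : S → A → B → ℝ) (p : S → A → B → S → ℝ)
    (v : S → ℝ) (s : S) (x : B → stdSimplex ℝ A) (y : stdSimplex ℝ B) : ℝ :=
  ∑ b, (y : B → ℝ) b * ∑ a, (x b : A → ℝ) a * (r s a b + γ * ∑ s', p s a b s' * v s')

variable [Fintype S]

lemma PPol_mulVec (π : S → B → stdSimplex ℝ A) (ρ : S → stdSimplex ℝ B) (v : S → ℝ) (s : S) :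
    (PPol p π ρ).mulVec v s =
      ∑ b, (ρ s : B → ℝ) b * ∑ a, (π s b : A → ℝ) a * ∑ s', p s a b s' * v s' := by
  simp only [Matrix.mulVec, dotProduct, PPol, Finset.sum_mul, Finset.mul_sum, mul_assoc]
  rw [Finset.sum_comm]
  exact Finset.sum_congr rfl fun b _ => Finset.sum_comm

lemma PPol_sum (hp1 : ∀ s a b, ∑ s', p s a b s' = 1)
    (π : S → B → stdSimplex ℝ A) (ρ : S → stdSimplex ℝ B) (s : S) :
    ∑ s', PPol p π ρ s s' = 1 := by
  have h := PPol_mulVec (p := p) π ρ 1 s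
  have hπ : ∀ b, ∑ a, (π s b : A → ℝ) a = 1 := fun b => (π s b).2.2
  have hρ : ∑ b, (ρ s : B → ℝ) b = 1 := (ρ s).2.2
  simpa only [Matrix.mulVec, dotProduct, Pi.one_apply, mul_one, hp1, hπ, hρ] using h

lemma qFn_eq (γ : ℝ) (r : S → A → B → ℝ) (π : S → B → stdSimplex ℝ A) (ρ : S → stdSimplex ℝ B)
    (v : S → ℝ) (s : S) :
    qFn γ r p v s (π s) (ρ s) = rPol r π ρ s + γ * (PPol p π ρ).mulVec v s := by
  rw [PPol_mulVec, qFn, rPol, Finset.mul_sum, ← Finset.sum_add_distrib]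
  refine Finset.sum_congr rfl fun b _ => ?_
  rw [mul_left_comm, ← mul_add, Finset.mul_sum _ _ γ, ← Finset.sum_add_distrib]
  congr 1
  exact Finset.sum_congr rfl fun a _ => by ring

lemma continuous_qFn (γ : ℝ) (r : S → A → B → ℝ) (v : S → ℝ) (s : S) (x : B → stdSimplex ℝ A) :
    Continuous (qFn γ r p v s x) :=
  continuous_finsetSum _ fun b _ =>
    ((continuous_apply b).comp continuous_subtype_val).mul continuous_const

variable [DecidableEq S] {γ : ℝ}

lemma vFn_eq (hγ0 : 0 ≤ γ) (hγ1 : γ < 1) (r : S → A → B → ℝ)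
    (hp0 : ∀ s a b s', 0 ≤ p s a b s') (hp1 : ∀ s a b, ∑ s', p s a b s' = 1)
    (π : S → B → stdSimplex ℝ A) (ρ : S → stdSimplex ℝ B) (s : S) :
    vFn γ r p π ρ s = rPol r π ρ s + γ * (PPol p π ρ).mulVec (vFn γ r p π ρ) s :=
  tsum_discounted_eq_of_stochastic (PPol_nonneg hp0 π ρ) (PPol_sum hp1 π ρ) hγ0 hγ1 _ s

variable [Nonempty S]

lemma qFn_le_vFn_of_le_qFn (hγ0 : 0 ≤ γ) (hγ1 : γ < 1) (r : S → A → B → ℝ)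
    (hp0 : ∀ s a b s', 0 ≤ p s a b s') (hp1 : ∀ s a b, ∑ s', p s a b s' = 1)
    (π : S → B → stdSimplex ℝ A) (ρ : S → stdSimplex ℝ B) {w : S → ℝ}
    (hw : ∀ s, w s ≤ qFn γ r p w s (π s) (ρ s)) (s : S) :
    qFn γ r p w s (π s) (ρ s) ≤ vFn γ r p π ρ s := by
  have hP0 := PPol_nonneg hp0 π ρ
  have hv := vFn_eq hγ0 hγ1 r hp0 hp1 π ρ
  have he : ∀ s, 0 ≤ (vFn γ r p π ρ - w) s :=
    nonneg_of_discounted_mulVec_le hP0 (PPol_sum hp1 π ρ) hγ0 hγ1 fun s => by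
      have := hw s
      rw [qFn_eq] at this
      rw [Matrix.mulVec_sub, Pi.sub_apply, Pi.sub_apply]
      linarith [hv s]
  have h := mul_nonneg hγ0 (le_mulVec_of_stochastic hP0 (PPol_sum hp1 π ρ) he s)
  rw [Matrix.mulVec_sub, Pi.sub_apply] at h
  rw [qFn_eq, hv s]
  linarith

lemma vFn_le_qFn_of_qFn_le (hγ0 : 0 ≤ γ) (hγ1 : γ < 1) (r : S → A → B → ℝ)
    (hp0 : ∀ s a b s', 0 ≤ p s a b s') (hp1 : ∀ s a b, ∑ s', p s a b s' = 1)
    (π : S → B → stdSimplex ℝ A) (ρ : S → stdSimplex ℝ B) {w : S → ℝ}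
    (hw : ∀ s, qFn γ r p w s (π s) (ρ s) ≤ w s) (s : S) :
    vFn γ r p π ρ s ≤ qFn γ r p w s (π s) (ρ s) := by
  have hP0 := PPol_nonneg hp0 π ρ
  have hv := vFn_eq hγ0 hγ1 r hp0 hp1 π ρ
  have he : ∀ s, 0 ≤ (w - vFn γ r p π ρ) s :=
    nonneg_of_discounted_mulVec_le hP0 (PPol_sum hp1 π ρ) hγ0 hγ1 fun s => by
      have := hw s
      rw [qFn_eq] at this
      rw [Matrix.mulVec_sub, Pi.sub_apply, Pi.sub_apply]
      linarith [hv s]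
  have h := mul_nonneg hγ0 (le_mulVec_of_stochastic hP0 (PPol_sum hp1 π ρ) he s)
  rw [Matrix.mulVec_sub, Pi.sub_apply] at h
  rw [qFn_eq, hv s]
  linarith

/-- One-shot deviations of the agent from an optimal response are not profitable. -/
lemma qFn_le_vFn_of_isBestResponse (hγ0 : 0 ≤ γ) (hγ1 : γ < 1) (r : S → A → B → ℝ)
    (hp0 : ∀ s a b s', 0 ≤ p s a b s') (hp1 : ∀ s a b, ∑ s', p s a b s' = 1)
    {π : S → B → stdSimplex ℝ A} {ρ : S → stdSimplex ℝ B}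
    (hbest : ∀ π' s, vFn γ r p π' ρ s ≤ vFn γ r p π ρ s) (s : S) (x : B → stdSimplex ℝ A) :
    qFn γ r p (vFn γ r p π ρ) s x (ρ s) ≤ vFn γ r p π ρ s := by
  by_contra! hlt
  have hw : ∀ t, vFn γ r p π ρ t ≤
      qFn γ r p (vFn γ r p π ρ) t (Function.update π s x t) (ρ t) := fun t => by
    rcases eq_or_ne t s with rfl | ht
    · rw [Function.update_self]
      exact hlt.le
    · rw [Function.update_of_ne ht, qFn_eq, ← vFn_eq hγ0 hγ1 r hp0 hp1]
  have h := qFn_le_vFn_of_le_qFn hγ0 hγ1 r hp0 hp1 _ ρ hw s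
  rw [Function.update_self] at h
  exact (hlt.trans_le h).not_ge (hbest _ s)

/-- One-shot deviations of the adversary from an optimal response are not profitable. -/
lemma vFn_le_qFn_of_isBestResponse (hγ0 : 0 ≤ γ) (hγ1 : γ < 1) (r : S → A → B → ℝ)
    (hp0 : ∀ s a b s', 0 ≤ p s a b s') (hp1 : ∀ s a b, ∑ s', p s a b s' = 1)
    {π : S → B → stdSimplex ℝ A} {ρ : S → stdSimplex ℝ B}
    (hbest : ∀ ρ' s, vFn γ r p π ρ s ≤ vFn γ r p π ρ' s) (s : S) (y : stdSimplex ℝ B) :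
    vFn γ r p π ρ s ≤ qFn γ r p (vFn γ r p π ρ) s (π s) y := by
  by_contra! hlt
  have hw : ∀ t, qFn γ r p (vFn γ r p π ρ) t (π t) (Function.update ρ s y t) ≤
      vFn γ r p π ρ t := fun t => by
    rcases eq_or_ne t s with rfl | ht
    · rw [Function.update_self]
      exact hlt.le
    · rw [Function.update_of_ne ht, qFn_eq, ← vFn_eq hγ0 hγ1 r hp0 hp1]
  have h := vFn_le_qFn_of_qFn_le hγ0 hγ1 r hp0 hp1 π _ hw s
  rw [Function.update_self] at h
  exact (h.trans_lt hlt).not_ge (hbest _ s)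

end Policy

end MGSPA

/-- (Theorem 4.4-(3), robust equilibrium satisfies the Bellman equation.)
If `(π*, ρ*)` is a robust equilibrium, then its value function is a fixed
point of the minimax Bellman operator: `L v_{π*,ρ*} = v_{π*,ρ*}`. -/
theorem robust_equilibrium_satisfies_bellman
    {S A B : Type*} [Fintype S] [DecidableEq S] [Nonempty S]
    [Fintype A] [Nonempty A] [Fintype B] [Nonempty B]
    (γ : ℝ) (hγ0 : 0 ≤ γ) (hγ1 : γ < 1)
    (r : S → A → B → ℝ) (p : S → A → B → S → ℝ)
    (hp0 : ∀ s a b s', 0 ≤ p s a b s')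
    (hp1 : ∀ s a b, ∑ s', p s a b s' = 1)
    (πstar : S → B → stdSimplex ℝ A) (ρstar : S → stdSimplex ℝ B)
    (hre : ∀ (π : S → B → stdSimplex ℝ A) (ρ : S → stdSimplex ℝ B) (s : S),
      vFn γ r p π ρstar s ≤ vFn γ r p πstar ρstar s ∧
      vFn γ r p πstar ρstar s ≤ vFn γ r p πstar ρ s) :
    Lop γ r p (vFn γ r p πstar ρstar) = vFn γ r p πstar ρstar := by
  have hx := qFn_le_vFn_of_isBestResponse hγ0 hγ1 r hp0 hp1 fun π s => (hre π ρstar s).1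
  have hy := vFn_le_qFn_of_isBestResponse hγ0 hγ1 r hp0 hp1 fun ρ s => (hre πstar ρ s).2
  funext s
  have hinf : ∀ x, ⨅ y, qFn γ r p (vFn γ r p πstar ρstar) s x y ≤ vFn γ r p πstar ρstar s :=
    fun x => (ciInf_le (isCompact_range (continuous_qFn γ r _ s x)).bddBelow (ρstar s)).trans
      (hx s x)
  have : Nonempty (stdSimplex ℝ A) := ⟨πstar s (Classical.arbitrary B)⟩
  have : Nonempty (stdSimplex ℝ B) := ⟨ρstar s⟩
  refine le_antisymm (ciSup_le hinf) ?_
  exact (le_ciInf (hy s)).trans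
    (le_ciSup (f := fun x => ⨅ y, qFn γ r p (vFn γ r p πstar ρstar) s x y)
      ⟨_, Set.forall_mem_range.2 hinf⟩ (πstar s))
end

section
/- (Policy gradient with respect to the agents' parameters, the exact discounted form of Theorem 5.2.) In an MG-SPA, fix an adversary policy ρ : S → stdSimplex ℝ B and let π : ℝ → S → (B → stdSimplex ℝ A) be a parameterized family of agent policies such that for every s ∈ S, b ∈ B, a ∈ A the map θ ↦ (π θ s b) a is differentiable on ℝ. For θ ∈ ℝ write v_θ := v_{π θ, ρ} and P_θ := P_{π θ, ρ}, and define q_θ(s, a, b) := r s a b + γ · ∑_{s'} p s a b s' · v_θ(s'). Then for every s ∈ S and θ₀ ∈ ℝ, the map θ ↦ v_θ(s) is differentiable at θ₀ with derivative ∑'_{k=0}^{∞} γ^k · ∑_{x ∈ S} ((P_{θ₀})^k)(s, x) · ∑_{b} (ρ x) b · ∑_{a} (deriv (fun θ => (π θ x b) a) θ₀) · q_{θ₀}(x, a, b). -/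
open scoped BigOperators

section Resolvent

open scoped Matrix.Norms.Operator

variable {S : Type*} [Fintype S] [DecidableEq S]

/-- The discounted resolvent `(1 - γ P)⁻¹` applied to a vector is its Neumann series. -/
theorem hasSum_discounted_mulVec {γ : ℝ} {P : Matrix S S ℝ} (h : ‖γ • P‖ < 1)
    (u : S → ℝ) (s : S) :
    HasSum (fun t : ℕ => γ ^ t * ((P ^ t).mulVec u) s)
      ((Ring.inverse (1 - γ • P)).mulVec u s) := by
  have hc : Continuous (fun M : Matrix S S ℝ => M.mulVec u s) :=
    (continuous_apply s).comp (continuous_id.matrix_mulVec continuous_const)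
  have hs := (hasSum_geom_series_inverse _ h).map
    ((Pi.evalAddMonoidHom (fun _ : S => ℝ) s).comp (Matrix.mulVec.addMonoidHomLeft u)) hc
  refine hs.congr_fun ?_
  intro t
  simp [smul_pow, Matrix.smul_mulVec, Function.comp_def, Matrix.mulVec.addMonoidHomLeft]

/-- Derivative of `θ ↦ (1 - γ P θ)⁻¹ r θ`. -/
theorem hasDerivAt_resolvent_mulVec {γ : ℝ} {P : ℝ → Matrix S S ℝ} {P' : Matrix S S ℝ}
    {r : ℝ → S → ℝ} {r' : S → ℝ} {θ₀ : ℝ} (h : ‖γ • P θ₀‖ < 1)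
    (hP : ∀ i j, HasDerivAt (fun θ => P θ i j) (P' i j) θ₀)
    (hr : ∀ i, HasDerivAt (fun θ => r θ i) (r' i) θ₀) (s : S) :
    HasDerivAt (fun θ => (Ring.inverse (1 - γ • P θ)).mulVec (r θ) s)
      ((Ring.inverse (1 - γ • P θ₀)).mulVec
        (r' + γ • P'.mulVec ((Ring.inverse (1 - γ • P θ₀)).mulVec (r θ₀))) s) θ₀ := by
  have hPm : HasDerivAt P P' θ₀ :=
    hasDerivAt_pi.2 fun i => hasDerivAt_pi.2 fun j => hP i j
  obtain ⟨U, hU⟩ := isUnit_one_sub_of_norm_lt_one h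
  have hN := (hPm.const_smul γ).const_sub 1
  have hI := (hU ▸ hasFDerivAt_ringInverse (𝕜 := ℝ) U).comp_hasDerivAt θ₀ hN
  have hR : ∀ j, HasDerivAt (fun θ => Ring.inverse (1 - γ • P θ) s j)
    ((Ring.inverse (1 - γ • P θ₀) * (γ • P') * Ring.inverse (1 - γ • P θ₀)) s j) θ₀ := by
    intro j
    refine (hasDerivAt_pi.1 (hasDerivAt_pi.1 hI s) j).congr_deriv ?_
    rw [← hU, Ring.inverse_unit]
    simp
  refine (HasDerivAt.fun_sum (u := Finset.univ) fun j _ => (hR j).mul (hr j)).congr_deriv ?_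
  rw [Finset.sum_add_distrib, add_comm]
  simp only [← Matrix.smul_mulVec, Matrix.mulVec_add, Pi.add_apply, Matrix.mulVec_mulVec,
    mul_assoc, smul_mul_assoc]
  rfl

end Resolvent

section StochasticNorm

open scoped Matrix.Norms.Operator

variable {S A B : Type*}

/-- A discounted stochastic matrix is a strict contraction in the sup operator norm. -/
theorem norm_smul_PPol_lt_one [Fintype S] [Fintype A] [Fintype B]
    {γ : ℝ} (hγ0 : 0 ≤ γ) (hγ1 : γ < 1) {p : S → A → B → S → ℝ}
    (hp0 : ∀ s a b s', 0 ≤ p s a b s') (hp1 : ∀ s a b, ∑ s', p s a b s' = 1)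
    (π : S → B → stdSimplex ℝ A) (ρ : S → stdSimplex ℝ B) :
    ‖γ • PPol p π ρ‖ < 1 := by
  have hP : ‖PPol p π ρ‖ ≤ 1 := by
    rw [Matrix.linfty_opNorm_def]
    rw [← NNReal.coe_one, NNReal.coe_le_coe]
    refine Finset.sup_le fun i _ => ?_
    rw [← NNReal.coe_le_coe]
    push_cast
    have h0 : ∀ j, 0 ≤ PPol p π ρ i j := fun j =>
      Finset.sum_nonneg fun b _ => mul_nonneg ((ρ i).2.1 b) <|
        Finset.sum_nonneg fun a _ => mul_nonneg ((π i b).2.1 a) (hp0 i a b j)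
    simp only [Real.norm_of_nonneg (h0 _)]
    refine le_of_eq ?_
    unfold PPol
    have h1 : ∀ b, ∑ a, (π i b : A → ℝ) a = 1 := fun b => (π i b).2.2
    have h2 : ∑ b, (ρ i : B → ℝ) b = 1 := (ρ i).2.2
    rw [Finset.sum_comm]
    simp only [← Finset.mul_sum]
    rw [← h2]
    refine Finset.sum_congr rfl fun b _ => ?_
    rw [Finset.sum_comm]
    simp only [← Finset.mul_sum, hp1, h1, mul_one]
  rw [norm_smul, Real.norm_of_nonneg hγ0]
  nlinarith [norm_nonneg (PPol p π ρ)]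

end StochasticNorm

/-- (Theorem 5.2, exact discounted policy gradient with respect to the agents'
parameter.)  For a differentiably parameterized family of agent policies
`π : ℝ → S → (B → stdSimplex ℝ A)` and a fixed adversary policy `ρ`, the map
`θ ↦ v_{π θ, ρ}(s)` is differentiable, with derivative
`∑' k, γ^k * ∑ x, (P_{θ₀}^k) s x * ∑ b, (ρ x) b * ∑ a, ∂θ (π θ x b) a * q_{θ₀}(x,a,b)`. -/
theorem policy_gradient_agents
    {S A B : Type*} [Fintype S] [DecidableEq S] [Nonempty S]
    [Fintype A] [Nonempty A] [Fintype B] [Nonempty B]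
    (γ : ℝ) (hγ0 : 0 ≤ γ) (hγ1 : γ < 1)
    (r : S → A → B → ℝ) (p : S → A → B → S → ℝ)
    (hp0 : ∀ s a b s', 0 ≤ p s a b s')
    (hp1 : ∀ s a b, ∑ s', p s a b s' = 1)
    (ρ : S → stdSimplex ℝ B)
    (π : ℝ → S → B → stdSimplex ℝ A)
    (hπ : ∀ (s : S) (b : B) (a : A),
      Differentiable ℝ (fun θ : ℝ => (π θ s b : A → ℝ) a))
    (s : S) (θ₀ : ℝ) :
    HasDerivAt (fun θ : ℝ => vFn γ r p (π θ) ρ s)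
      (∑' k : ℕ, γ ^ k *
        ∑ x : S, ((PPol p (π θ₀) ρ) ^ k) s x *
          ∑ b, (ρ x : B → ℝ) b *
            ∑ a, deriv (fun θ : ℝ => (π θ x b : A → ℝ) a) θ₀ *
              (r x a b + γ * ∑ s', p x a b s' * vFn γ r p (π θ₀) ρ s'))
      θ₀ := by
  have hN := fun θ => norm_smul_PPol_lt_one hγ0 hγ1 hp0 hp1 (π θ) ρ
  have hv : ∀ θ x, vFn γ r p (π θ) ρ x =
      (Ring.inverse (1 - γ • PPol p (π θ) ρ)).mulVec (rPol r (π θ) ρ) x := fun θ x =>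
    (hasSum_discounted_mulVec (hN θ) _ x).tsum_eq
  have hmix : ∀ (x : S) (c : A → B → ℝ), HasDerivAt
      (fun θ => ∑ b, (ρ x : B → ℝ) b * ∑ a, (π θ x b : A → ℝ) a * c a b)
      (∑ b, (ρ x : B → ℝ) b * ∑ a, deriv (fun θ => (π θ x b : A → ℝ) a) θ₀ * c a b) θ₀ :=
    fun x c => HasDerivAt.fun_sum fun b _ => (HasDerivAt.fun_sum fun a _ =>
      ((hπ x b a θ₀).hasDerivAt.mul_const _)).const_mul _
  have hd := hasDerivAt_resolvent_mulVec (P := fun θ => PPol p (π θ) ρ)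
    (r := fun θ => rPol r (π θ) ρ)
    (P' := fun i j => _) (r' := fun i => _) (hN θ₀)
    (fun i j => hmix i fun a b => p i a b j) (fun i => hmix i (r i)) s
  rw [← funext (hv θ₀)] at hd
  simp only [← hv] at hd
  refine hd.congr_deriv ?_
  rw [← (hasSum_discounted_mulVec (hN θ₀) _ s).tsum_eq]
  refine tsum_congr fun k => congrArg (γ ^ k * ·) (Finset.sum_congr rfl fun x _ => ?_)
  congr 1
  simp only [Pi.add_apply, Pi.smul_apply, smul_eq_mul, Matrix.mulVec, dotProduct]
  simp only [mul_add, Finset.sum_add_distrib, add_right_inj, Finset.sum_mul, Finset.mul_sum]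
  rw [Finset.sum_comm]
  refine Finset.sum_congr rfl fun b _ => ?_
  rw [Finset.sum_comm]
  refine Finset.sum_congr rfl fun a _ => Finset.sum_congr rfl fun x' _ => ?_
  ring
end
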